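/- Let μlb ≤ μub be real numbers, let ζ ≥ 0, let l = μlb − ζ and u = μub + ζ, and let σ > 0. Then for every μ with μlb ≤ μ ≤ μub, C(μ, σ, u, l) ≥ C(μlb, σ, u, l), and moreover C(μlb, σ, u, l) = C(μub, σ, u, l). Here C(m, σ, u, l) := ((gaussianReal m σ²) (Set.Icc l u)).toReal. -/

import Mathlib

open ProbabilityTheory

/-- `C m σ u l` is the probability that a Gaussian with mean `m` and standard
deviation `σ` lies in the interval `[l, u]`. -/
noncomputable def C (m σ u l : ℝ) : ℝ :=
  ((gaussianReal m (Real.toNNReal σ ^ 2)) (Set.Icc l u)).toReal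

open MeasureTheory
open scoped NNReal

theorem gaussianPDFReal_zero_neg (v : ℝ≥0) (x : ℝ) :
    gaussianPDFReal 0 v (-x) = gaussianPDFReal 0 v x := by
  simp [gaussianPDFReal]

theorem gaussianPDFReal_zero_antitoneOn (v : ℝ≥0) :
    AntitoneOn (gaussianPDFReal 0 v) (Set.Ici 0) := by
  intro x hx y _ hxy
  rw [Set.mem_Ici] at hx
  simp only [gaussianPDFReal, sub_zero]
  gcongr

theorem intervalIntegrable_gaussianPDFReal (μ : ℝ) (v : ℝ≥0) (a b : ℝ) :
    IntervalIntegrable (gaussianPDFReal μ v) volume a b :=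
  (integrable_gaussianPDFReal μ v).intervalIntegrable

theorem gaussianReal_Icc_toReal (m : ℝ) {v : ℝ≥0} (hv : v ≠ 0) {l u : ℝ} (hlu : l ≤ u) :
    (gaussianReal m v (Set.Icc l u)).toReal =
      ∫ x in (l - m)..(u - m), gaussianPDFReal 0 v x := by
  rw [gaussianReal_apply_eq_integral m hv, ENNReal.toReal_ofReal
    (integral_nonneg fun x => gaussianPDFReal_nonneg m v x), integral_Icc_eq_integral_Ioc,
    ← intervalIntegral.integral_of_le hlu,
    ← intervalIntegral.integral_comp_sub_right (gaussianPDFReal 0 v) m]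
  simp [gaussianPDFReal]

/-- Translating a window `[s, t]` towards the origin does not decrease the integral of a centred
Gaussian density over it. -/
theorem integral_gaussianPDFReal_le_shift (v : ℝ≥0) {s t d : ℝ} (hs : s ≤ 0) (hd : 0 ≤ d)
    (h : d - s ≤ t) :
    ∫ x in s..t, gaussianPDFReal 0 v x ≤ ∫ x in (s - d)..(t - d), gaussianPDFReal 0 v x := by
  have hI := intervalIntegrable_gaussianPDFReal 0 v
  have hleft : ∫ x in (s - d)..s, gaussianPDFReal 0 v x =
      ∫ x in (0 : ℝ)..d, gaussianPDFReal 0 v (x + -s) := by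
    rw [intervalIntegral.integral_comp_add_right (gaussianPDFReal 0 v) (-s),
      zero_add, show d + -s = -(s - d) by ring, ← intervalIntegral.integral_comp_neg]
    simp only [gaussianPDFReal_zero_neg]
  have hright : ∫ x in (t - d)..t, gaussianPDFReal 0 v x =
      ∫ x in (0 : ℝ)..d, gaussianPDFReal 0 v (x + (t - d)) := by
    rw [intervalIntegral.integral_comp_add_right (gaussianPDFReal 0 v) (t - d),
      zero_add, add_sub_cancel]
  have hle : ∫ x in (t - d)..t, gaussianPDFReal 0 v x ≤
      ∫ x in (s - d)..s, gaussianPDFReal 0 v x := by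
    rw [hleft, hright]
    refine intervalIntegral.integral_mono_on hd
      ((integrable_gaussianPDFReal 0 v).comp_add_right (t - d)).intervalIntegrable
      ((integrable_gaussianPDFReal 0 v).comp_add_right (-s)).intervalIntegrable fun x hx => ?_
    have hx0 := hx.1
    exact gaussianPDFReal_zero_antitoneOn v (Set.mem_Ici.2 (by linarith))
      (Set.mem_Ici.2 (by linarith)) (by linarith)
  have h₁ := intervalIntegral.integral_add_adjacent_intervals (hI (s - d) s) (hI s t)
  have h₂ := intervalIntegral.integral_add_adjacent_intervals (hI (s - d) (t - d)) (hI (t - d) t)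
  linarith

theorem gaussian_interval_prob_min_at_endpoints
    (μlb μub ζ l u σ : ℝ)
    (hμ : μlb ≤ μub) (hζ : 0 ≤ ζ)
    (hli : l = μlb - ζ) (hui : u = μub + ζ) (hσ : 0 < σ) :
    (∀ μ : ℝ, μlb ≤ μ → μ ≤ μub → C μ σ u l ≥ C μlb σ u l) ∧
      C μlb σ u l = C μub σ u l := by
  have hv : Real.toNNReal σ ^ 2 ≠ 0 := pow_ne_zero 2 (Real.toNNReal_pos.2 hσ).ne'
  have hlu : l ≤ u := by linarith
  simp only [C, gaussianReal_Icc_toReal _ hv hlu]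
  constructor
  · intro μ h₁ h₂
    have h := integral_gaussianPDFReal_le_shift (Real.toNNReal σ ^ 2)
      (s := l - μlb) (t := u - μlb) (d := μ - μlb) (by linarith) (by linarith) (by linarith)
    simpa only [sub_sub_sub_cancel_right, sub_sub, add_sub_cancel] using h
  · rw [show l - μub = -(u - μlb) by linarith, show u - μub = -(l - μlb) by linarith,
      ← intervalIntegral.integral_comp_neg]
    simp only [gaussianPDFReal_zero_neg]
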